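/- arXiv:1103.3891 — 2 statements merged into one kernel-verified Lean document; each statement's English description precedes it below -/
import Mathlib

section
/- Fix an integer weight α ≥ 1 and for n ≥ 1 set L_n = span_ℂ{X_{jk}μ^a, Y_{jk}μ^a : j + k ≥ 1, j + k − 1 + α|a| = n} and R_n = span_ℂ{(zw)^i μ^a : 2i + α|a| = n} (scalar polynomials), where |a| = a₁ + ⋯ + a_m. Then: (i) ((zw)^i μ^a)·e = Y_{(i+1)i}μ^a; (ii) ad_e maps L_n into itself; and (iii) L_n is the internal direct sum ad_e(L_n) ⊕ R_n·e ⊕ span_ℂ{X_{(k+1)k}μ^a : 2k + α|a| = n}, where R_n·e = {T·e : T ∈ R_n}. (This identifies the first-level parametric normal form complement for the Hopf singularity.) -/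
open MvPolynomial

/-- Parametric planar polynomial vector fields: pairs of polynomials in
`z = X (inl 0)`, `w = X (inl 1)` and the parameters `μ_i = X (inr i)`. -/
abbrev ParamVF (m : ℕ) := MvPolynomial (Fin 2 ⊕ Fin m) ℂ × MvPolynomial (Fin 2 ⊕ Fin m) ℂ

/-- `μ^a = μ₁^{a₁} ⋯ μ_m^{a_m}`. -/
noncomputable def muPow {m : ℕ} (a : Fin m → ℕ) : MvPolynomial (Fin 2 ⊕ Fin m) ℂ :=
  ∏ i, X (Sum.inr i) ^ a i

/-- `Du·v` with formal partial derivatives taken only with respect to `z` and `w`. -/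
noncomputable def paramD {m : ℕ} (u v : ParamVF m) : ParamVF m :=
  (pderiv (Sum.inl 0) u.1 * v.1 + pderiv (Sum.inl 1) u.1 * v.2,
   pderiv (Sum.inl 0) u.2 * v.1 + pderiv (Sum.inl 1) u.2 * v.2)

/-- The bracket `[u, v] = Du·v − Dv·u`. -/
noncomputable def paramBracket {m : ℕ} (u v : ParamVF m) : ParamVF m :=
  paramD u v - paramD v u

/-- `X_{jk} μ^a = (z^j w^k μ^a, w^j z^k μ^a)`. -/
noncomputable def paramX {m : ℕ} (j k : ℕ) (a : Fin m → ℕ) : ParamVF m :=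
  (X (Sum.inl 0) ^ j * X (Sum.inl 1) ^ k * muPow a,
   X (Sum.inl 1) ^ j * X (Sum.inl 0) ^ k * muPow a)

/-- `Y_{jk} μ^a = (i z^j w^k μ^a, −i w^j z^k μ^a)`. -/
noncomputable def paramY {m : ℕ} (j k : ℕ) (a : Fin m → ℕ) : ParamVF m :=
  (C Complex.I * (X (Sum.inl 0) ^ j * X (Sum.inl 1) ^ k * muPow a),
   -(C Complex.I) * (X (Sum.inl 1) ^ j * X (Sum.inl 0) ^ k * muPow a))

/-- `e = Y_{10} = (iz, −iw)` (with trivial parameter part). -/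
noncomputable def paramE {m : ℕ} : ParamVF m := paramY 1 0 0

/-- `ad_e = [e, ·]` as a `ℂ`-linear map. -/
noncomputable def paramAdE {m : ℕ} : ParamVF m →ₗ[ℂ] ParamVF m where
  toFun u := paramBracket paramE u
  map_add' u v := by
    refine Prod.ext ?_ ?_ <;>
      simp [paramBracket, paramD, map_add] <;> ring
  map_smul' c u := by
    refine Prod.ext ?_ ?_ <;>
      simp [paramBracket, paramD, smul_eq_C_mul] <;> ring

/-- Multiplication of a scalar polynomial `T` into both components of `e`, `T ↦ T·e`,
as a `ℂ`-linear map. -/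
noncomputable def paramMulE {m : ℕ} : MvPolynomial (Fin 2 ⊕ Fin m) ℂ →ₗ[ℂ] ParamVF m where
  toFun T := (T * paramE.1, T * paramE.2)
  map_add' T S := by refine Prod.ext ?_ ?_ <;> simp [add_mul]
  map_smul' c T := by refine Prod.ext ?_ ?_ <;> simp [smul_eq_C_mul] <;> ring

/-- `L_n`: the span of the `X_{jk} μ^a`, `Y_{jk} μ^a` with `j + k ≥ 1` and grade
`j + k − 1 + α|a| = n`. -/
noncomputable def paramL (m : ℕ) (α n : ℕ) : Submodule ℂ (ParamVF m) :=
  Submodule.span ℂ {p : ParamVF m | ∃ (j k : ℕ) (a : Fin m → ℕ),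
    1 ≤ j + k ∧ j + k - 1 + α * (∑ i, a i) = n ∧ (p = paramX j k a ∨ p = paramY j k a)}

/-- `R_n`: the span of the scalar polynomials `(zw)^i μ^a` with `2i + α|a| = n`. -/
noncomputable def paramR (m : ℕ) (α n : ℕ) : Submodule ℂ (MvPolynomial (Fin 2 ⊕ Fin m) ℂ) :=
  Submodule.span ℂ {T : MvPolynomial (Fin 2 ⊕ Fin m) ℂ | ∃ (i : ℕ) (a : Fin m → ℕ),
    2 * i + α * (∑ i', a i') = n ∧ T = (X (Sum.inl 0) * X (Sum.inl 1)) ^ i * muPow a}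

lemma aux_mulE {m : ℕ} (i : ℕ) (a : Fin m → ℕ) :
    paramMulE ((X (Sum.inl 0) * X (Sum.inl 1)) ^ i * muPow a) = paramY (i + 1) i a := by
  refine Prod.ext ?_ ?_ <;> simp [paramMulE, paramE, paramY, muPow] <;> ring

lemma aux_pderiv_mu {m : ℕ} (a : Fin m → ℕ) (t : Fin 2) :
    pderiv (Sum.inl t) (muPow a) = 0 := by
  unfold muPow
  refine Finset.prod_induction _ (fun p => pderiv (Sum.inl t) p = 0) ?_ ?_ ?_
  · intro p q hp hq
    simp [Derivation.leibniz, hp, hq]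
  · simp
  · intro i _
    simp [Derivation.leibniz_pow, pderiv_X]

lemma aux_adE_fst {m : ℕ} (u : ParamVF m) :
    (paramAdE u).1 = C Complex.I * (u.1 - X (Sum.inl 0) * pderiv (Sum.inl 0) u.1
      + X (Sum.inl 1) * pderiv (Sum.inl 1) u.1) := by
  simp [paramAdE, paramBracket, paramD, paramE, paramY, muPow, pderiv_X]
  ring

lemma aux_adE_snd {m : ℕ} (u : ParamVF m) :
    (paramAdE u).2 = C Complex.I * (-u.2 - X (Sum.inl 0) * pderiv (Sum.inl 0) u.2
      + X (Sum.inl 1) * pderiv (Sum.inl 1) u.2) := by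
  simp [paramAdE, paramBracket, paramD, paramE, paramY, muPow, pderiv_X]
  ring

lemma aux_euler {m : ℕ} (j k : ℕ) (a : Fin m → ℕ) :
    X (Sum.inl 0) * pderiv (Sum.inl 0) (X (Sum.inl 0) ^ j * X (Sum.inl 1) ^ k * muPow a) =
      C (j : ℂ) * (X (Sum.inl 0) ^ j * X (Sum.inl 1) ^ k * muPow a) ∧
    X (Sum.inl 1) * pderiv (Sum.inl 1) (X (Sum.inl 0) ^ j * X (Sum.inl 1) ^ k * muPow a) =
      C (k : ℂ) * (X (Sum.inl 0) ^ j * X (Sum.inl 1) ^ k * muPow a) := by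
  constructor
  · rcases j with _ | j <;>
      simp [aux_pderiv_mu, Derivation.leibniz, Derivation.leibniz_pow, pderiv_X] <;> ring
  · rcases k with _ | k <;>
      simp [aux_pderiv_mu, Derivation.leibniz, Derivation.leibniz_pow, pderiv_X] <;> ring

lemma aux_CI {m : ℕ} : (C Complex.I * C Complex.I : MvPolynomial (Fin 2 ⊕ Fin m) ℂ) = -1 := by
  rw [← C_mul, Complex.I_mul_I]; simp

lemma aux_adX {m : ℕ} (j k : ℕ) (a : Fin m → ℕ) :
    paramAdE (paramX j k a) = (1 - j + k : ℂ) • paramY j k a := by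
  refine Prod.ext ?_ ?_
  · rw [aux_adE_fst]
    simp only [paramX, paramY, Prod.smul_fst, smul_eq_C_mul, (aux_euler j k a).1,
      (aux_euler j k a).2, C_add, C_sub, C_1]
    ring
  · rw [aux_adE_snd]
    simp only [paramX, paramY, Prod.smul_snd, smul_eq_C_mul, C_add, C_sub, C_1]
    rw [mul_comm (X (Sum.inl 1) ^ j) (X (Sum.inl 0) ^ k), (aux_euler k j a).1,
      (aux_euler k j a).2]
    ring

lemma aux_adY {m : ℕ} (j k : ℕ) (a : Fin m → ℕ) :
    paramAdE (paramY j k a) = (-(1 - j + k) : ℂ) • paramX j k a := by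
  have h : paramY j k a = (Complex.I • (paramX j k a).1, -Complex.I • (paramX j k a).2) := by
    refine Prod.ext ?_ ?_ <;> simp [paramX, paramY, smul_eq_C_mul]
  refine Prod.ext ?_ ?_
  · rw [aux_adE_fst, h]
    simp only [paramX, Prod.smul_fst, Derivation.map_smul, mul_smul_comm, (aux_euler j k a).1,
      (aux_euler j k a).2]
    simp only [smul_eq_C_mul, C_add, C_sub, C_1, C_neg]
    linear_combination (1 - C (j:ℂ) + C (k:ℂ)) *
      (X (Sum.inl 0) ^ j * X (Sum.inl 1) ^ k * muPow a) * aux_CI (m := m)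
  · rw [aux_adE_snd, h]
    simp only [paramX, Prod.smul_snd, Derivation.map_smul, mul_smul_comm]
    rw [mul_comm (X (Sum.inl 1) ^ j) (X (Sum.inl 0) ^ k), (aux_euler k j a).1,
      (aux_euler k j a).2]
    simp only [smul_eq_C_mul, C_add, C_sub, C_1, C_neg]
    linear_combination (1 - C (j:ℂ) + C (k:ℂ)) *
      (X (Sum.inl 0) ^ k * X (Sum.inl 1) ^ j * muPow a) * aux_CI (m := m)

lemma aux_coeff_euler {m : ℕ} (t : Fin 2 ⊕ Fin m) (d : (Fin 2 ⊕ Fin m) →₀ ℕ)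
    (p : MvPolynomial (Fin 2 ⊕ Fin m) ℂ) :
    coeff d (X t * pderiv t p) = (d t : ℂ) * coeff d p := by
  classical
  induction p using MvPolynomial.induction_on' with
  | monomial s c =>
    rw [X_mul_pderiv_monomial]
    simp only [coeff_smul, coeff_monomial]
    split_ifs with h <;> simp [h]
  | add p q hp hq => simp only [map_add, mul_add, coeff_add, hp, hq]

/-- kernel and range of `ad_e` meet trivially -/
lemma aux_semisimple {m : ℕ} (u : ParamVF m) (h : paramAdE (paramAdE u) = 0) :
    paramAdE u = 0 := by
  have h1 := congrArg Prod.fst h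
  have h2 := congrArg Prod.snd h
  refine Prod.ext ?_ ?_
  · ext d
    have h3 := congrArg (coeff d) h1
    rw [aux_adE_fst, coeff_C_mul, coeff_add, coeff_sub, aux_coeff_euler, aux_coeff_euler] at h3
    have h4 : coeff d (paramAdE u).1 = Complex.I * ((1 - d (Sum.inl 0) + d (Sum.inl 1)) *
        coeff d u.1) := by
      rw [aux_adE_fst, coeff_C_mul, coeff_add, coeff_sub, aux_coeff_euler, aux_coeff_euler]
      ring
    have h5 : (1 - d (Sum.inl 0) + d (Sum.inl 1) : ℂ) * coeff d (paramAdE u).1 = 0 := by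
      have : Complex.I * ((1 - d (Sum.inl 0) + d (Sum.inl 1) : ℂ) * coeff d (paramAdE u).1) = 0 := by
        simp only [Prod.fst_zero, coeff_zero] at h3
        linear_combination h3
      simpa using this
    rcases mul_eq_zero.1 h5 with h6 | h6
    · rw [h4, h6]; simp
    · simpa using h6
  · ext d
    have h3 := congrArg (coeff d) h2
    rw [aux_adE_snd, coeff_C_mul, coeff_add, coeff_sub, coeff_neg, aux_coeff_euler,
      aux_coeff_euler] at h3
    have h4 : coeff d (paramAdE u).2 = Complex.I * ((-1 - d (Sum.inl 0) + d (Sum.inl 1)) *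
        coeff d u.2) := by
      rw [aux_adE_snd, coeff_C_mul, coeff_add, coeff_sub, coeff_neg, aux_coeff_euler,
        aux_coeff_euler]
      ring
    have h5 : (-1 - d (Sum.inl 0) + d (Sum.inl 1) : ℂ) * coeff d (paramAdE u).2 = 0 := by
      have : Complex.I * ((-1 - d (Sum.inl 0) + d (Sum.inl 1) : ℂ) * coeff d (paramAdE u).2) = 0 := by
        simp only [Prod.snd_zero, coeff_zero] at h3
        linear_combination h3
      simpa using this
    rcases mul_eq_zero.1 h5 with h6 | h6
    · rw [h4, h6]; simp
    · simpa using h6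

/-- the swap of the two planar variables -/
noncomputable def auxSwap (m : ℕ) : MvPolynomial (Fin 2 ⊕ Fin m) ℂ →ₐ[ℂ]
    MvPolynomial (Fin 2 ⊕ Fin m) ℂ :=
  rename (Sum.map (Equiv.swap (0 : Fin 2) 1) id)

lemma auxSwap_mu {m : ℕ} (a : Fin m → ℕ) : auxSwap m (muPow a) = muPow a := by
  simp [auxSwap, muPow]

lemma auxSwap_z {m : ℕ} : auxSwap m (X (Sum.inl 0)) = X (Sum.inl 1) := by
  simp [auxSwap]

lemma auxSwap_w {m : ℕ} : auxSwap m (X (Sum.inl 1)) = X (Sum.inl 0) := by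
  simp [auxSwap]

lemma auxSwap_C {m : ℕ} (c : ℂ) : auxSwap m (C c) = C c := by
  simp [auxSwap]

lemma aux_abs {M : Type*} [AddCommGroup M] [Module ℂ M] (f : M →ₗ[ℂ] M)
    (hf : ∀ u, f (f u) = 0 → f u = 0) (L B D : Submodule ℂ M)
    (hB : ∀ b ∈ B, f b = 0) (hD : ∀ b ∈ D, f b = 0) (hBD : ∀ b ∈ B, b ∈ D → b = 0) :
    Submodule.map f L ⊓ (B ⊔ D) = ⊥ ∧ B ⊓ (Submodule.map f L ⊔ D) = ⊥ ∧
      D ⊓ (Submodule.map f L ⊔ B) = ⊥ := by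
  refine ⟨?_, ?_, ?_⟩ <;> rw [Submodule.eq_bot_iff] <;> rintro x ⟨hx1, hx2⟩ <;>
    obtain ⟨y, hy, z, hz, rfl⟩ := Submodule.mem_sup.1 hx2
  · obtain ⟨u, -, hu⟩ := hx1
    rw [← hu]
    apply hf
    rw [hu, map_add, hB y hy, hD z hz, add_zero]
  · obtain ⟨u, -, rfl⟩ := hy
    have h0 : f u = 0 := by
      apply hf
      have := hB _ hx1
      rwa [map_add, hD z hz, add_zero] at this
    rw [h0, zero_add] at hx1 ⊢
    exact hBD z hx1 hz
  · obtain ⟨u, -, rfl⟩ := hy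
    have h0 : f u = 0 := by
      apply hf
      have := hD _ hx1
      rwa [map_add, hB z hz, add_zero] at this
    rw [h0, zero_add] at hx1 ⊢
    exact hBD z hz hx1

theorem paramL_first_level_decomposition (m : ℕ) (α : ℕ) (hα : 1 ≤ α) (n : ℕ) (hn : 1 ≤ n) :
    (∀ (i : ℕ) (a : Fin m → ℕ),
      paramMulE ((X (Sum.inl 0) * X (Sum.inl 1)) ^ i * muPow a) = paramY (i + 1) i a) ∧
    (∀ u ∈ paramL m α n, paramAdE u ∈ paramL m α n) ∧
    (Submodule.map paramAdE (paramL m α n) ⊔ Submodule.map paramMulE (paramR m α n) ⊔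
        Submodule.span ℂ {p : ParamVF m | ∃ (k : ℕ) (a : Fin m → ℕ),
          2 * k + α * (∑ i, a i) = n ∧ p = paramX (k + 1) k a} = paramL m α n ∧
      Submodule.map paramAdE (paramL m α n) ⊓ (Submodule.map paramMulE (paramR m α n) ⊔
        Submodule.span ℂ {p : ParamVF m | ∃ (k : ℕ) (a : Fin m → ℕ),
          2 * k + α * (∑ i, a i) = n ∧ p = paramX (k + 1) k a}) = ⊥ ∧
      Submodule.map paramMulE (paramR m α n) ⊓ (Submodule.map paramAdE (paramL m α n) ⊔
        Submodule.span ℂ {p : ParamVF m | ∃ (k : ℕ) (a : Fin m → ℕ),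
          2 * k + α * (∑ i, a i) = n ∧ p = paramX (k + 1) k a}) = ⊥ ∧
      Submodule.span ℂ {p : ParamVF m | ∃ (k : ℕ) (a : Fin m → ℕ),
          2 * k + α * (∑ i, a i) = n ∧ p = paramX (k + 1) k a} ⊓
        (Submodule.map paramAdE (paramL m α n) ⊔ Submodule.map paramMulE (paramR m α n)) = ⊥) := by
  have hinv : ∀ u ∈ paramL m α n, paramAdE u ∈ paramL m α n := by
    intro u hu
    induction hu using Submodule.span_induction with
    | mem x hx =>
      obtain ⟨j, k, a, h1, h2, rfl | rfl⟩ := hx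
      · rw [aux_adX]
        exact Submodule.smul_mem _ _ (Submodule.subset_span ⟨j, k, a, h1, h2, Or.inr rfl⟩)
      · rw [aux_adY]
        exact Submodule.smul_mem _ _ (Submodule.subset_span ⟨j, k, a, h1, h2, Or.inl rfl⟩)
    | zero => rw [map_zero]; exact Submodule.zero_mem _
    | add x y _ _ hx hy => rw [map_add]; exact Submodule.add_mem _ hx hy
    | smul c x _ hx => rw [map_smul]; exact Submodule.smul_mem _ _ hx
  have hmap : Submodule.map paramMulE (paramR m α n) =
      Submodule.span ℂ {p : ParamVF m | ∃ (k : ℕ) (a : Fin m → ℕ),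
          2 * k + α * (∑ i, a i) = n ∧ p = paramY (k + 1) k a} := by
    rw [paramR, Submodule.map_span]
    congr 1
    ext p
    constructor
    · rintro ⟨T, ⟨i, a, h, rfl⟩, rfl⟩
      exact ⟨i, a, h, aux_mulE i a⟩
    · rintro ⟨i, a, h, rfl⟩
      exact ⟨_, ⟨i, a, h, rfl⟩, aux_mulE i a⟩
  refine ⟨aux_mulE, hinv, ?_, ?_⟩
  · rw [hmap]
    apply le_antisymm
    · refine sup_le (sup_le ?_ ?_) ?_
      · rintro _ ⟨u, hu, rfl⟩
        exact hinv u hu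
      · rw [Submodule.span_le]
        rintro _ ⟨k, a, h, rfl⟩
        exact Submodule.subset_span ⟨k + 1, k, a, by omega, by rw [← h]; omega, Or.inr rfl⟩
      · rw [Submodule.span_le]
        rintro _ ⟨k, a, h, rfl⟩
        exact Submodule.subset_span ⟨k + 1, k, a, by omega, by rw [← h]; omega, Or.inl rfl⟩
    · conv_lhs => rw [paramL]
      rw [Submodule.span_le]
      rintro p ⟨j, k, a, h1, h2, hp⟩
      by_cases hjk : j = k + 1
      · subst hjk
        have h3 : 2 * k + α * (∑ i, a i) = n := by rw [← h2]; omega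
        rcases hp with rfl | rfl
        · exact Submodule.mem_sup_right (Submodule.subset_span ⟨k, a, h3, rfl⟩)
        · exact Submodule.mem_sup_left (Submodule.mem_sup_right
            (Submodule.subset_span ⟨k, a, h3, rfl⟩))
      · have hc : (1 - j + k : ℂ) ≠ 0 := by
          intro h
          apply hjk
          have : (j : ℂ) = ((k + 1 : ℕ) : ℂ) := by push_cast; linear_combination -h
          exact_mod_cast this
        refine Submodule.mem_sup_left (Submodule.mem_sup_left ?_)
        rcases hp with rfl | rfl
        · refine ⟨(-(1 - j + k : ℂ))⁻¹ • paramY j k a, Submodule.smul_mem _ _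
            (Submodule.subset_span ⟨j, k, a, h1, h2, Or.inr rfl⟩), ?_⟩
          rw [map_smul, aux_adY, smul_smul, inv_mul_cancel₀ (neg_ne_zero.2 hc), one_smul]
        · refine ⟨(1 - j + k : ℂ)⁻¹ • paramX j k a, Submodule.smul_mem _ _
            (Submodule.subset_span ⟨j, k, a, h1, h2, Or.inl rfl⟩), ?_⟩
          rw [map_smul, aux_adX, smul_smul, inv_mul_cancel₀ hc, one_smul]
  · rw [hmap]
    refine aux_abs paramAdE aux_semisimple _ _ _ ?_ ?_ ?_
    · intro b hb
      refine (Submodule.span_le (p := LinearMap.ker paramAdE)).2 ?_ hb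
      rintro _ ⟨k, a, -, rfl⟩
      simp [aux_adY]
    · intro b hb
      refine (Submodule.span_le (p := LinearMap.ker paramAdE)).2 ?_ hb
      rintro _ ⟨k, a, -, rfl⟩
      simp [aux_adX]
    · intro b hb hb'
      have hY : b.2 = -auxSwap m b.1 ∧ b.1 = -auxSwap m b.2 := by
        clear hb'
        induction hb using Submodule.span_induction with
        | mem x hx =>
          obtain ⟨k, a, -, rfl⟩ := hx
          constructor <;>
            simp [paramY, auxSwap_mu, auxSwap_z, auxSwap_w, auxSwap_C]
        | zero => simp
        | add x y _ _ hx hy =>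
          constructor
          · rw [Prod.snd_add, Prod.fst_add, hx.1, hy.1, map_add, neg_add]
          · rw [Prod.snd_add, Prod.fst_add, hx.2, hy.2, map_add, neg_add]
        | smul c x _ hx =>
          constructor
          · rw [Prod.smul_snd, Prod.smul_fst, hx.1, map_smul, smul_neg]
          · rw [Prod.smul_snd, Prod.smul_fst, hx.2, map_smul, smul_neg]
      have hX : b.2 = auxSwap m b.1 ∧ b.1 = auxSwap m b.2 := by
        clear hY hb
        induction hb' using Submodule.span_induction with
        | mem x hx =>
          obtain ⟨k, a, -, rfl⟩ := hx
          constructor <;>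
            simp [paramX, auxSwap_mu, auxSwap_z, auxSwap_w]
        | zero => simp
        | add x y _ _ hx hy =>
          constructor
          · rw [Prod.snd_add, Prod.fst_add, hx.1, hy.1, map_add]
          · rw [Prod.snd_add, Prod.fst_add, map_add, ← hx.2, ← hy.2]
        | smul c x _ hx =>
          constructor
          · rw [Prod.smul_snd, Prod.smul_fst, hx.1, map_smul]
          · rw [Prod.smul_snd, Prod.smul_fst, map_smul, ← hx.2]
      refine Prod.ext ?_ ?_
      · have := hY.2
        rw [← hX.2] at this
        exact self_eq_neg.1 this
      · have := hY.1
        rw [← hX.1] at this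
        exact self_eq_neg.1 this
end

section
/- The real span of {X_{jk}μ^a, Y_{jk}μ^a : j + k ≥ 1, a ∈ ℕ^m}, regarded as an ℝ-subspace of the space of pairs of complex polynomials in z, w, μ₁, …, μ_m, is closed under the bracket [u, v] = Du·v − Dv·u; that is, this real vector space is a real Lie algebra under the bracket (the parametric state space L). -/
open MvPolynomial

/-- `T c j k a = (c z^j w^k μ^a, conj c w^j z^k μ^a)`. -/
noncomputable def auxT {m : ℕ} (c : ℂ) (j k : ℕ) (a : Fin m → ℕ) : ParamVF m :=
  (C c * (X (Sum.inl 0) ^ j * X (Sum.inl 1) ^ k * muPow a),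
   C (starRingEnd ℂ c) * (X (Sum.inl 1) ^ j * X (Sum.inl 0) ^ k * muPow a))

/-- the state space -/
noncomputable def auxL (m : ℕ) : Submodule ℝ (ParamVF m) :=
  Submodule.span ℝ {p : ParamVF m | ∃ (j k : ℕ) (a : Fin m → ℕ),
        1 ≤ j + k ∧ (p = paramX j k a ∨ p = paramY j k a)}

theorem real_smul_eq {m : ℕ} (r : ℝ) (p : MvPolynomial (Fin 2 ⊕ Fin m) ℂ) :
    r • p = C (r : ℂ) * p := by
  rw [← MvPolynomial.smul_eq_C_mul]
  ext d
  simp [MvPolynomial.coeff_smul]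

theorem auxT_mem {m : ℕ} (c : ℂ) (j k : ℕ) (a : Fin m → ℕ) (h : 1 ≤ j + k) :
    auxT c j k a ∈ auxL m := by
  have e : auxT c j k a = c.re • paramX j k a + c.im • paramY j k a := by
    have h1 : (C c : MvPolynomial (Fin 2 ⊕ Fin m) ℂ)
        = C (c.re : ℂ) + C (c.im : ℂ) * C Complex.I := by
      rw [← C_mul, ← C_add, Complex.re_add_im]
    have h2 : (C (starRingEnd ℂ c) : MvPolynomial (Fin 2 ⊕ Fin m) ℂ)
        = C (c.re : ℂ) - C (c.im : ℂ) * C Complex.I := by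
      rw [← C_mul, ← C_sub]
      congr 1
      apply Complex.ext <;> simp
    refine Prod.ext ?_ ?_
    · simp only [auxT, paramX, paramY, Prod.fst_add, Prod.smul_fst, real_smul_eq, h1]
      ring
    · simp only [auxT, paramX, paramY, Prod.snd_add, Prod.smul_snd, real_smul_eq, h2]
      ring
  rw [e]
  exact Submodule.add_mem _
    (Submodule.smul_mem _ _ (Submodule.subset_span ⟨j, k, a, h, Or.inl rfl⟩))
    (Submodule.smul_mem _ _ (Submodule.subset_span ⟨j, k, a, h, Or.inr rfl⟩))

theorem pderiv_muPow {m : ℕ} (s : Fin 2) (a : Fin m → ℕ) :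
    pderiv (Sum.inl s) (muPow a) = 0 := by
  unfold muPow
  refine Finset.prod_induction _ (fun p => pderiv (Sum.inl s) p = 0) ?_ ?_ ?_
  · intro p q hp hq
    simp [pderiv_mul, hp, hq]
  · simp
  · intro i _
    simp [pderiv_pow, pderiv_X]

theorem muPow_add {m : ℕ} (a b : Fin m → ℕ) : muPow (a + b) = muPow a * muPow b := by
  simp [muPow, pow_add, Finset.prod_mul_distrib]

theorem paramD_auxT {m : ℕ} (c d : ℂ) (j k l n : ℕ) (a b : Fin m → ℕ) :
    paramD (auxT c j k a) (auxT d l n b) =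
      auxT (c * d * j) (j - 1 + l) (k + n) (a + b)
      + auxT (c * starRingEnd ℂ d * k) (j + n) (k - 1 + l) (a + b) := by
  refine Prod.ext ?_ ?_ <;>
  · simp [auxT, paramD, pderiv_mul, pderiv_pow, pderiv_muPow, muPow_add, pow_add, pderiv_X]
    ring

theorem paramD_auxT_mem {m : ℕ} (c d : ℂ) (j k l n : ℕ) (a b : Fin m → ℕ)
    (h' : 1 ≤ l + n) : paramD (auxT c j k a) (auxT d l n b) ∈ auxL m := by
  rw [paramD_auxT]
  refine Submodule.add_mem _ ?_ ?_
  · exact auxT_mem _ _ _ _ (by omega)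
  · exact auxT_mem _ _ _ _ (by omega)

theorem gen_eq {m : ℕ} {p : ParamVF m} (h : ∃ (j k : ℕ) (a : Fin m → ℕ),
    1 ≤ j + k ∧ (p = paramX j k a ∨ p = paramY j k a)) :
    ∃ (c : ℂ) (j k : ℕ) (a : Fin m → ℕ), 1 ≤ j + k ∧ p = auxT c j k a := by
  obtain ⟨j, k, a, h, rfl | rfl⟩ := h
  · exact ⟨1, j, k, a, h, by simp [auxT, paramX]⟩
  · exact ⟨Complex.I, j, k, a, h, by simp [auxT, paramY]⟩

theorem paramD_mem {m : ℕ} (u v : ParamVF m) (hu : u ∈ auxL m) (hv : v ∈ auxL m) :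
    paramD u v ∈ auxL m := by
  unfold auxL at hu hv
  induction hu, hv using Submodule.span_induction₂ with
  | mem_mem x y hx hy =>
    obtain ⟨c, j, k, a, h, rfl⟩ := gen_eq hx
    obtain ⟨d, l, n, b, h', rfl⟩ := gen_eq hy
    exact paramD_auxT_mem _ _ _ _ _ _ _ _ h'
  | zero_left y hy =>
    have : paramD 0 y = 0 := by simp [paramD]
    rw [this]; exact Submodule.zero_mem _
  | zero_right x hx =>
    have : paramD x 0 = 0 := by simp [paramD]
    rw [this]; exact Submodule.zero_mem _
  | add_left x y z hx hy hz h1 h2 =>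
    have : paramD (x + y) z = paramD x z + paramD y z := by
      refine Prod.ext ?_ ?_ <;> · simp [paramD]; ring
    rw [this]; exact Submodule.add_mem _ h1 h2
  | add_right x y z hx hy hz h1 h2 =>
    have : paramD x (y + z) = paramD x y + paramD x z := by
      refine Prod.ext ?_ ?_ <;> · simp [paramD]; ring
    rw [this]; exact Submodule.add_mem _ h1 h2
  | smul_left r x y hx hy h =>
    have : paramD (r • x) y = r • paramD x y := by
      refine Prod.ext ?_ ?_ <;> · simp [paramD, real_smul_eq, pderiv_mul]; ring
    rw [this]; exact Submodule.smul_mem _ _ h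
  | smul_right r x y hx hy h =>
    have : paramD x (r • y) = r • paramD x y := by
      refine Prod.ext ?_ ?_ <;> · simp [paramD, real_smul_eq]; ring
    rw [this]; exact Submodule.smul_mem _ _ h

/-- The real span of the `X_{jk} μ^a`, `Y_{jk} μ^a` with `j + k ≥ 1` (the parametric state
space `L`) is closed under the bracket: it is a real Lie algebra. -/
theorem paramStateSpace_closed_under_bracket (m : ℕ) :
    ∀ u ∈ Submodule.span ℝ {p : ParamVF m | ∃ (j k : ℕ) (a : Fin m → ℕ),
        1 ≤ j + k ∧ (p = paramX j k a ∨ p = paramY j k a)},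
      ∀ v ∈ Submodule.span ℝ {p : ParamVF m | ∃ (j k : ℕ) (a : Fin m → ℕ),
        1 ≤ j + k ∧ (p = paramX j k a ∨ p = paramY j k a)},
      paramBracket u v ∈ Submodule.span ℝ {p : ParamVF m | ∃ (j k : ℕ) (a : Fin m → ℕ),
        1 ≤ j + k ∧ (p = paramX j k a ∨ p = paramY j k a)} := by
  intro u hu v hv
  exact Submodule.sub_mem _ (paramD_mem u v hu hv) (paramD_mem v u hv hu)
end
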